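/- Let 𝓗 be a real Hilbert space, ψ : X → 𝓗 a measurable feature map with kernel K(x,x′) = ⟨ψ(x), ψ(x′)⟩ satisfying K(x,x) ≤ u² for all x ∈ X, and let P be a probability measure on X × {−1,1}. Fix v > 0, γ > 1, r > 0, δ ∈ (0,1), an integer m ≥ 1, and assume the events appearing below are measurable. Then with P^m-probability at least 1 − δ over an i.i.d. sample (x_1,y_1),…,(x_m,y_m) from P, for every ζ ∈ (0, r]: inf_{w ∈ 𝓗, ‖w‖ ≤ v} R_rob^ζ(x ↦ ⟨w, ψ(x)⟩) − inf_{α ∈ ℝ^m, αᵀ𝐊α ≤ v²} (1/m) ∑_{i=1}^m φ_{2,ζ}(y_i · (𝐊α)_i) ≤ (2γ/ζ)√(u²v²/m) + √(log(log_γ(γr/ζ))/m) + √(log(2/δ)/(2m)), where 𝐊 = [K(x_i,x_j)]_{ij} is the Gram matrix of the sample. -/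

import Mathlib

open MeasureTheory Matrix
open scoped RealInnerProductSpace

/-- Surrogate loss `φ_{λ,ζ}(z) = max(0, λ − z/ζ)`. -/
noncomputable def phi (lam ζ z : ℝ) : ℝ := max 0 (lam - z / ζ)

/-- Gram matrix `𝐊 = [K(x_i,x_j)]_{ij} = [⟪ψ(x_i), ψ(x_j)⟫]_{ij}` of a sample. -/
noncomputable def gram {𝓗 X : Type*} [NormedAddCommGroup 𝓗] [InnerProductSpace ℝ 𝓗]
    (ψ : X → 𝓗) {m : ℕ} (x : Fin m → X) : Matrix (Fin m) (Fin m) ℝ :=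
  Matrix.of fun i j => ⟪ψ (x i), ψ (x j)⟫

theorem measurePreserving_finCons {Z : Type*} [MeasurableSpace Z] (P : Measure Z)
    [IsProbabilityMeasure P] (m : ℕ) :
    MeasurePreserving (fun p : Z × (Fin m → Z) => (Fin.cons p.1 p.2 : Fin (m + 1) → Z))
      (P.prod (Measure.pi fun _ => P)) (Measure.pi fun _ => P) := by
  have h := (measurePreserving_piFinSuccAbove (fun _ : Fin (m + 1) => P) 0).symm
  convert h using 1
  funext p
  exact (Fin.insertNth_zero (α := fun _ => Z) p.1 p.2).symm

theorem integrable_of_abs_le {Ω : Type*} [MeasurableSpace Ω] {μ : Measure Ω}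
    [IsFiniteMeasure μ] {f : Ω → ℝ} (hf : Measurable f) {C : ℝ} (hC : ∀ x, |f x| ≤ C) :
    Integrable f μ :=
  Integrable.of_bound hf.aestronglyMeasurable C (Filter.Eventually.of_forall hC)

/-- The Hoeffding lemma for a function of oscillation at most one. -/
theorem integral_exp_le_of_sub_le_one {Z : Type*} [MeasurableSpace Z] (P : Measure Z)
    [IsProbabilityMeasure P] (s : ℝ) (f : Z → ℝ) (hf : Measurable f) (C : ℝ)
    (hC : ∀ x, |f x| ≤ C) (hd : ∀ x y, f x - f y ≤ 1) :
    ∫ x, Real.exp (s * (f x - ∫ y, f y ∂P)) ∂P ≤ Real.exp (s ^ 2 / 8) := by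
  have hne : Nonempty Z := nonempty_of_isProbabilityMeasure P
  have hb : BddBelow (Set.range f) := ⟨-C, by
    rintro _ ⟨x, rfl⟩; exact (abs_le.1 (hC x)).1⟩
  have h := ProbabilityTheory.hasSubgaussianMGF_of_mem_Icc (μ := P) (X := f)
    (a := ⨅ x, f x) (b := (⨅ x, f x) + 1) hf.aemeasurable
    (Filter.Eventually.of_forall fun x => ⟨ciInf_le hb x, by
      have : f x - 1 ≤ ⨅ x, f x := le_ciInf fun y => by linarith [hd x y]
      linarith⟩)
  refine (h.mgf_le s).trans (Real.exp_le_exp.2 ?_)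
  simp only [NNReal.coe_pow, NNReal.coe_div, coe_nnnorm, add_sub_cancel_left, norm_one,
    NNReal.coe_ofNat]
  linarith

/-- The exponential moment bound behind the McDiarmid inequality. -/
theorem integral_exp_le_of_bounded_differences {Z : Type*} [MeasurableSpace Z] (P : Measure Z)
    [IsProbabilityMeasure P] (s : ℝ) (m : ℕ) (F : (Fin m → Z) → ℝ) (hF : Measurable F) (C : ℝ)
    (hC : ∀ S, |F S| ≤ C) (hd : ∀ S i z, F (Function.update S i z) - F S ≤ 1) :
    ∫ S, Real.exp (s * (F S - ∫ T, F T ∂(Measure.pi fun _ => P))) ∂(Measure.pi fun _ => P)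
      ≤ Real.exp (m * s ^ 2 / 8) := by
  induction m with
  | zero =>
    have : ∀ S, F S = F default := fun S => congrArg F (Subsingleton.elim _ _)
    simp [this]
  | succ m ih =>
    have hcons := measurePreserving_finCons P m
    set ν : Measure (Fin m → Z) := Measure.pi fun _ => P with hν
    set c : Z × (Fin m → Z) → (Fin (m + 1) → Z) := fun p => Fin.cons p.1 p.2 with hc
    have hFc : Measurable fun p => F (c p) := hF.comp hcons.measurable
    have hint : ∀ G : (Fin (m + 1) → Z) → ℝ, Measurable G → (∃ D, ∀ S, |G S| ≤ D) →
        ∫ S, G S ∂(Measure.pi fun _ => P) = ∫ S, ∫ x, G (c (x, S)) ∂P ∂ν := by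
      rintro G hG ⟨D, hD⟩
      rw [← integral_prod_symm (fun p => G (c p))
        (integrable_of_abs_le (hG.comp hcons.measurable) fun _ => hD _), ← hcons.map_eq,
        integral_map hcons.measurable.aemeasurable hG.aestronglyMeasurable]
    set E := ∫ T, F T ∂(Measure.pi fun _ : Fin (m + 1) => P) with hE
    set G : (Fin m → Z) → ℝ := fun S => ∫ x, F (c (x, S)) ∂P with hG
    have hGm : Measurable G :=
      (hFc.stronglyMeasurable.integral_prod_left').measurable
    have hslice : ∀ S, Measurable fun x => F (c (x, S)) := fun S =>
      hFc.comp measurable_prodMk_right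
    have hGC : ∀ S, |G S| ≤ C := fun S => by
      have := norm_integral_le_of_norm_le_const (μ := P) (f := fun x => F (c (x, S))) (C := C)
        (Filter.Eventually.of_forall fun x => hC _)
      simpa using this
    have hEG : E = ∫ S, G S ∂ν := hint F hF ⟨C, hC⟩
    have hGd : ∀ S i z, G (Function.update S i z) - G S ≤ 1 := fun S i z => by
      rw [hG]
      simp only
      rw [← integral_sub (integrable_of_abs_le (hslice _) fun _ => hC _)
        (integrable_of_abs_le (hslice _) fun _ => hC _)]
      have : ∫ x, (F (c (x, Function.update S i z)) - F (c (x, S))) ∂P ≤ ∫ _x, (1 : ℝ) ∂P := by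
        refine integral_mono ((integrable_of_abs_le (hslice _) fun _ => hC _).sub
          (integrable_of_abs_le (hslice _) fun _ => hC _)) (integrable_const _) fun x => ?_
        simp only [hc, Fin.cons_update]
        exact hd _ _ _
      simpa using this
    have hexpb : ∀ r : ℝ, |r| ≤ C + |E| → Real.exp (s * r) ≤ Real.exp (|s| * (C + |E|)) :=
      fun r hr => Real.exp_le_exp.2 ((le_abs_self _).trans (by
        rw [abs_mul]; exact mul_le_mul_of_nonneg_left hr (abs_nonneg _)))
    have hIH := ih G hGm hGC hGd
    rw [← hEG] at hIH
    rw [hint (fun S => Real.exp (s * (F S - E))) (by fun_prop)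
      ⟨Real.exp (|s| * (C + |E|)), fun S => by
        rw [abs_of_pos (Real.exp_pos _)]
        exact hexpb _ ((abs_sub _ _).trans (by linarith [hC S]))⟩]
    have hpt : ∀ S, ∫ x, Real.exp (s * (F (c (x, S)) - E)) ∂P
        ≤ Real.exp (s * (G S - E)) * Real.exp (s ^ 2 / 8) := fun S => by
      have h1 := integral_exp_le_of_sub_le_one P s (fun x => F (c (x, S))) (hslice S) C
        (fun _ => hC _) (fun x y => by
          have := hd (c (y, S)) 0 x
          simpa only [hc, Fin.update_cons_zero] using this)
      have h2 : ∀ x, Real.exp (s * (F (c (x, S)) - E))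
          = Real.exp (s * (G S - E)) * Real.exp (s * (F (c (x, S)) - G S)) := fun x => by
        rw [← Real.exp_add]; congr 1; ring
      simp_rw [h2]
      rw [integral_const_mul]
      exact mul_le_mul_of_nonneg_left h1 (Real.exp_pos _).le
    have hexpG : Integrable (fun S => Real.exp (s * (G S - E))) ν :=
      integrable_of_abs_le (by fun_prop) (C := Real.exp (|s| * (C + |E|))) fun S => by
        rw [abs_of_pos (Real.exp_pos _)]
        exact hexpb _ ((abs_sub _ _).trans (by linarith [hGC S]))
    calc _ ≤ ∫ S, Real.exp (s * (G S - E)) * Real.exp (s ^ 2 / 8) ∂ν := by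
          refine integral_mono_of_nonneg
            (Filter.Eventually.of_forall fun S => integral_nonneg fun x => (Real.exp_pos _).le)
            (hexpG.mul_const _) (Filter.Eventually.of_forall hpt)
      _ = (∫ S, Real.exp (s * (G S - E)) ∂ν) * Real.exp (s ^ 2 / 8) := integral_mul_const _ _
      _ ≤ Real.exp (m * s ^ 2 / 8) * Real.exp (s ^ 2 / 8) :=
          mul_le_mul_of_nonneg_right hIH (Real.exp_pos _).le
      _ = Real.exp ((m + 1 : ℕ) * s ^ 2 / 8) := by
          rw [← Real.exp_add]; push_cast; congr 1; ring

/-- The McDiarmid inequality for functions with differences bounded by one. -/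
theorem measure_ge_le_of_bounded_differences {Z : Type*} [MeasurableSpace Z] (P : Measure Z)
    [IsProbabilityMeasure P] (m : ℕ) (F : (Fin m → Z) → ℝ) (hF : Measurable F)
    (C : ℝ) (hC : ∀ S, |F S| ≤ C) (hd : ∀ S i z, F (Function.update S i z) - F S ≤ 1)
    (ε : ℝ) (hε : 0 ≤ ε) :
    (Measure.pi fun _ => P) {S | m * ε ≤ F S - ∫ T, F T ∂(Measure.pi fun _ => P)}
      ≤ ENNReal.ofReal (Real.exp (-2 * m * ε ^ 2)) := by
  set ν : Measure (Fin m → Z) := Measure.pi fun _ => P with hν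
  set E := ∫ T, F T ∂ν with hE
  have hmgf := integral_exp_le_of_bounded_differences P (4 * ε) m F hF C hC hd
  rw [← hν, ← hE] at hmgf
  have hint : Integrable (fun S => Real.exp (4 * ε * (F S - E))) ν :=
    integrable_of_abs_le (by fun_prop) (C := Real.exp (4 * ε * (C + |E|))) fun S => by
      rw [abs_of_pos (Real.exp_pos _)]
      refine Real.exp_le_exp.2 (mul_le_mul_of_nonneg_left ?_ (by positivity))
      linarith [(abs_le.1 (hC S)).2, neg_abs_le E]
  have h := ProbabilityTheory.measure_ge_le_exp_mul_mgf (X := fun S => F S - E) (μ := ν)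
    (m * ε) (t := 4 * ε) (by positivity) hint
  rw [← ofReal_measureReal]
  refine ENNReal.ofReal_le_ofReal (h.trans ?_)
  calc _ ≤ Real.exp (-(4 * ε) * (m * ε)) * Real.exp (m * (4 * ε) ^ 2 / 8) :=
        mul_le_mul_of_nonneg_left hmgf (Real.exp_pos _).le
    _ = Real.exp (-2 * m * ε ^ 2) := by rw [← Real.exp_add]; congr 1; ring

/-- The sign `±1` attached to a Boolean. -/
def boolSign (b : Bool) : ℝ := if b then 1 else -1

theorem boolSign_true : boolSign true = 1 := rfl

theorem boolSign_false : boolSign false = -1 := rfl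

theorem sum_bool_pi_succ {m : ℕ} (f : (Fin (m + 1) → Bool) → ℝ) :
    ∑ σ, f σ = ∑ σ : Fin m → Bool, (f (Fin.cons true σ) + f (Fin.cons false σ)) := by
  rw [← (Fin.consEquiv fun _ => Bool).sum_comp, Fintype.sum_prod_type, Fintype.sum_bool,
    ← Finset.sum_add_distrib]
  rfl

/-- The Ledoux–Talagrand contraction principle, in terms of selections rather than suprema:
`U` is any upper bound for the signed sums of the dominating functions `h`. -/
theorem sum_signs_contraction {ι : Type*} (m : ℕ) (A : ι → ℝ) (f h : Fin m → ι → ℝ)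
    (hfh : ∀ i s t, |f i s - f i t| ≤ |h i s - h i t|)
    (U : (Fin m → Bool) → ℝ) (hU : ∀ σ t, A t + ∑ i, boolSign (σ i) * h i t ≤ U σ)
    (t : (Fin m → Bool) → ι) :
    ∑ σ, (A (t σ) + ∑ i, boolSign (σ i) * f i (t σ)) ≤ ∑ σ, U σ := by
  induction m generalizing A with
  | zero => exact Finset.sum_le_sum fun σ _ => by simpa using hU σ (t σ)
  | succ m ih =>
    rw [sum_bool_pi_succ, sum_bool_pi_succ]
    set R : (Fin m → Bool) → ι → ℝ := fun σ s => ∑ i, boolSign (σ i) * f i.succ s with hR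
    have key : ∀ σ : Fin m → Bool, ∃ p q : ι,
        (A (t (Fin.cons true σ)) +
            ∑ i, boolSign ((Fin.cons true σ : Fin (m + 1) → Bool) i) * f i (t (Fin.cons true σ))) +
          (A (t (Fin.cons false σ)) +
            ∑ i, boolSign ((Fin.cons false σ : Fin (m + 1) → Bool) i) *
              f i (t (Fin.cons false σ)))
        ≤ (A p + h 0 p + R σ p) + (A q - h 0 q + R σ q) := by
      intro σ
      set p := t (Fin.cons true σ)
      set q := t (Fin.cons false σ)
      simp only [Fin.sum_univ_succ, Fin.cons_zero, Fin.cons_succ]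
      have h1 := (le_abs_self _).trans (hfh 0 p q)
      rcases abs_cases (h 0 p - h 0 q) with ⟨h2, _⟩ | ⟨h2, _⟩
      · exact ⟨p, q, by simp only [boolSign_true, boolSign_false, hR]; linarith⟩
      · exact ⟨q, p, by simp only [boolSign_true, boolSign_false, hR]; linarith⟩
    choose p q hpq using key
    have hp := ih (fun s => A s + h 0 s) (fun i => f i.succ) (fun i => h i.succ)
      (fun i => hfh i.succ) (fun σ => U (Fin.cons true σ)) (fun σ s => by
        have := hU (Fin.cons true σ) s
        simp only [Fin.sum_univ_succ, Fin.cons_zero, Fin.cons_succ, boolSign_true] at this ⊢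
        linarith) p
    have hq := ih (fun s => A s - h 0 s) (fun i => f i.succ) (fun i => h i.succ)
      (fun i => hfh i.succ) (fun σ => U (Fin.cons false σ)) (fun σ s => by
        have := hU (Fin.cons false σ) s
        simp only [Fin.sum_univ_succ, Fin.cons_zero, Fin.cons_succ, boolSign_false] at this ⊢
        linarith) q
    rw [Finset.sum_add_distrib (f := fun σ => U (Fin.cons true σ))]
    refine (Finset.sum_le_sum fun σ _ => hpq σ).trans ?_
    rw [Finset.sum_add_distrib]
    exact add_le_add hp hq

theorem sum_iSup_le_of_selection {κ ι : Type*} [Fintype κ] [Nonempty ι] (a : κ → ι → ℝ) (C : ℝ)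
    (h : ∀ t : κ → ι, ∑ k, a k (t k) ≤ C) : ∑ k, ⨆ i, a k i ≤ C := by
  refine le_of_forall_pos_le_add fun ε hε => ?_
  rcases isEmpty_or_nonempty κ with hκ | hκ
  · have := h isEmptyElim
    simp only [Finset.univ_eq_empty, Finset.sum_empty] at this ⊢
    linarith
  have hc : (0 : ℝ) < Fintype.card κ := by exact_mod_cast Fintype.card_pos
  have : ∀ k, ∃ i, (⨆ i, a k i) - ε / Fintype.card κ < a k i := fun k =>
    exists_lt_of_lt_ciSup (sub_lt_self _ (by positivity))
  choose t ht using this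
  have h1 := Finset.sum_le_sum (s := Finset.univ) fun k _ => (ht k).le
  rw [Finset.sum_sub_distrib] at h1
  simp only [Finset.sum_const, Finset.card_univ, nsmul_eq_mul] at h1
  rw [mul_div_cancel₀ _ hc.ne'] at h1
  linarith [h t]

theorem sum_signs_mul_sign {m : ℕ} (i j : Fin m) :
    ∑ σ : Fin m → Bool, boolSign (σ i) * boolSign (σ j) = if i = j then 2 ^ m else 0 := by
  split_ifs with hij
  · subst hij
    have : ∀ b, boolSign b * boolSign b = 1 := by intro b; cases b <;> simp [boolSign]
    simp [this]
  · have hinv : Function.Involutive fun σ : Fin m → Bool => Function.update σ i (!σ i) := by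
      intro σ; simp
    have h := (Equiv.sum_comp (hinv.toPerm _)
      fun σ : Fin m → Bool => boolSign (σ i) * boolSign (σ j))
    have hneg : ∀ σ : Fin m → Bool, boolSign (hinv.toPerm _ σ i) * boolSign (hinv.toPerm _ σ j)
        = -(boolSign (σ i) * boolSign (σ j)) := by
      intro σ
      have h1 : hinv.toPerm _ σ i = !σ i := by simp
      have h2 : hinv.toPerm _ σ j = σ j := by simp [Ne.symm hij]
      rw [h1, h2]
      cases σ i <;> simp [boolSign_true, boolSign_false]
    simp_rw [hneg] at h
    rw [Finset.sum_neg_distrib] at h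
    linarith

theorem sum_signs_norm_sq {E : Type*} [NormedAddCommGroup E] [InnerProductSpace ℝ E] {m : ℕ}
    (y : Fin m → E) :
    ∑ σ : Fin m → Bool, ‖∑ i, boolSign (σ i) • y i‖ ^ 2 = 2 ^ m * ∑ i, ‖y i‖ ^ 2 := by
  have h : ∀ σ : Fin m → Bool, ‖∑ i, boolSign (σ i) • y i‖ ^ 2
      = ∑ i, ∑ j, boolSign (σ i) * boolSign (σ j) * ⟪y i, y j⟫ := fun σ => by
    rw [← real_inner_self_eq_norm_sq, sum_inner]
    simp_rw [inner_sum, real_inner_smul_left, real_inner_smul_right, mul_assoc]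
  simp_rw [h]
  rw [Finset.sum_comm]
  simp_rw [Finset.sum_comm (s := (Finset.univ : Finset (Fin m → Bool))), ← Finset.sum_mul,
    sum_signs_mul_sign]
  simp [Finset.mul_sum]

/-- Averages over signs of `B √(‖∑ ± yᵢ‖² + q)` are controlled by `B √(∑ ‖yᵢ‖² + q)`. -/
theorem sum_signs_sqrt_le {E : Type*} [NormedAddCommGroup E] [InnerProductSpace ℝ E] {m : ℕ}
    (y : Fin m → E) (B q : ℝ) (hB : 0 ≤ B) (hq : 0 ≤ q) :
    ∑ σ : Fin m → Bool, B * Real.sqrt (‖∑ i, boolSign (σ i) • y i‖ ^ 2 + q)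
      ≤ 2 ^ m * (B * Real.sqrt (∑ i, ‖y i‖ ^ 2 + q)) := by
  rw [← Finset.mul_sum, mul_left_comm]
  refine mul_le_mul_of_nonneg_left ?_ hB
  have h := sq_sum_le_card_mul_sum_sq (s := (Finset.univ : Finset (Fin m → Bool)))
    (f := fun σ => Real.sqrt (‖∑ i, boolSign (σ i) • y i‖ ^ 2 + q))
  have hs : ∀ σ : Fin m → Bool, Real.sqrt (‖∑ i, boolSign (σ i) • y i‖ ^ 2 + q) ^ 2
      = ‖∑ i, boolSign (σ i) • y i‖ ^ 2 + q := fun σ => Real.sq_sqrt (by positivity)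
  simp_rw [hs] at h
  rw [Finset.sum_add_distrib, sum_signs_norm_sq] at h
  simp only [Finset.card_univ, Fintype.card_pi, Fintype.card_bool, Finset.prod_const,
    Fintype.card_fin, Finset.sum_const, nsmul_eq_mul, Nat.cast_pow, Nat.cast_ofNat] at h
  refine abs_le_of_sq_le_sq' ?_ (by positivity) |>.2
  refine h.trans (le_of_eq ?_)
  rw [mul_pow, Real.sq_sqrt (by positivity)]
  ring

/-- The surrogate loss `φ_{2,1}` clipped at one. -/
noncomputable def clippedLoss (z : ℝ) : ℝ := min 1 (max 0 (2 - z))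

theorem clippedLoss_nonneg (z : ℝ) : 0 ≤ clippedLoss z := le_min zero_le_one (le_max_left _ _)

theorem clippedLoss_le_one (z : ℝ) : clippedLoss z ≤ 1 := min_le_left _ _

theorem continuous_clippedLoss : Continuous clippedLoss := by unfold clippedLoss; fun_prop

theorem abs_clippedLoss_sub_le (a b : ℝ) : |clippedLoss a - clippedLoss b| ≤ |a - b| := by
  unfold clippedLoss
  refine (abs_min_sub_min_le_max _ _ _ _).trans (max_le (by simp) ?_)
  refine (abs_max_sub_max_le_max _ _ _ _).trans (max_le (by simp) ?_)
  rw [sub_sub_sub_cancel_left, abs_sub_comm]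

theorem clippedLoss_eq_one {z : ℝ} (h : z ≤ 1) : clippedLoss z = 1 :=
  min_eq_left (le_max_of_le_right (by linarith))

theorem abs_iSup_le {ι : Type*} [Nonempty ι] {f : ι → ℝ} {C : ℝ} (h : ∀ i, |f i| ≤ C) :
    |⨆ i, f i| ≤ C := by
  have hb : BddAbove (Set.range f) := ⟨C, by rintro _ ⟨i, rfl⟩; exact (abs_le.1 (h i)).2⟩
  obtain ⟨i⟩ := ‹Nonempty ι›
  exact abs_le.2 ⟨(abs_le.1 (h i)).1.trans (le_ciSup hb i),
    haveI : Nonempty ι := ⟨i⟩; ciSup_le fun j => (abs_le.1 (h j)).2⟩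

theorem mul_add_mul_le_of_sq_add_sq_le {a b p q B : ℝ} (hB : 0 ≤ B) (h : a ^ 2 + b ^ 2 ≤ B ^ 2) :
    a * p + b * q ≤ B * Real.sqrt (p ^ 2 + q ^ 2) := by
  refine abs_le_of_sq_le_sq' ?_ (by positivity) |>.2
  rw [mul_pow, Real.sq_sqrt (by positivity)]
  nlinarith [sq_nonneg (a * q - b * p), mul_le_mul_of_nonneg_right h
    (add_nonneg (sq_nonneg p) (sq_nonneg q))]

/-- Rademacher bound for a contracted linear class with an additional nonnegative offset. -/
theorem sum_signs_contracted_linear_le {E ι : Type*} [NormedAddCommGroup E]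
    [InnerProductSpace ℝ E] {m : ℕ} (y : Fin m → E) (w : ι → E) (θ : ι → ℝ) (B H : ℝ)
    (hB : 0 ≤ B) (hw : ∀ s, ‖w s‖ ^ 2 + θ s ^ 2 ≤ B ^ 2) (f : Fin m → ι → ℝ)
    (hf : ∀ i s t, |f i s - f i t| ≤ |⟪w s, y i⟫ - ⟪w t, y i⟫|) (t : (Fin m → Bool) → ι) :
    ∑ σ, (θ (t σ) * H + ∑ i, boolSign (σ i) * f i (t σ))
      ≤ 2 ^ m * (B * Real.sqrt (∑ i, ‖y i‖ ^ 2 + H ^ 2)) := by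
  refine (sum_signs_contraction m (fun s => θ s * H) f (fun i s => ⟪w s, y i⟫) hf
    (fun σ => B * Real.sqrt (‖∑ i, boolSign (σ i) • y i‖ ^ 2 + H ^ 2)) (fun σ s => ?_) t).trans
    (sum_signs_sqrt_le y B (H ^ 2) hB (sq_nonneg H))
  have h1 : ∑ i, boolSign (σ i) * ⟪w s, y i⟫ = ⟪w s, ∑ i, boolSign (σ i) • y i⟫ := by
    simp_rw [inner_sum, real_inner_smul_right]
  rw [h1]
  refine le_trans ?_ (mul_add_mul_le_of_sq_add_sq_le hB (hw s))
  linarith [real_inner_le_norm (w s) (∑ i, boolSign (σ i) • y i)]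

/-- Bound on the sum over all signs of the symmetrized suprema. -/
theorem sum_signs_iSup_le {E ι : Type*} [Nonempty ι] [NormedAddCommGroup E]
    [InnerProductSpace ℝ E] {m : ℕ} (y y' : Fin m → E) (e e' : Fin m → ℝ) (u : ℝ)
    (hy : ∀ i, ‖y i‖ ^ 2 + e i ^ 2 ≤ u ^ 2) (hy' : ∀ i, ‖y' i‖ ^ 2 + e' i ^ 2 ≤ u ^ 2)
    (w : ι → E) (θ : ι → ℝ) (B : ℝ)
    (hB : 0 ≤ B) (hw : ∀ s, ‖w s‖ ^ 2 + θ s ^ 2 ≤ B ^ 2) :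
    ∑ σ : Fin m → Bool, (⨆ s, (∑ i, boolSign (σ i) *
        (clippedLoss ⟪w s, y' i⟫ - clippedLoss ⟪w s, y i⟫)
        + θ s * Real.sqrt (∑ i, (e i ^ 2 + e' i ^ 2))))
      ≤ 2 ^ m * (2 * B * Real.sqrt (m * u ^ 2)) := by
  refine sum_iSup_le_of_selection _ _ fun t => ?_
  set H := Real.sqrt (∑ i, (e i ^ 2 + e' i ^ 2)) / 2 with hH
  have hH2 : H ^ 2 = (∑ i, (e i ^ 2 + e' i ^ 2)) / 4 := by
    rw [hH, div_pow, Real.sq_sqrt (Finset.sum_nonneg fun i _ => by positivity)]; norm_num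
  have h1 := sum_signs_contracted_linear_le y' w θ B H hB hw
    (fun i s => clippedLoss ⟪w s, y' i⟫) (fun i s t => abs_clippedLoss_sub_le _ _) t
  have h2 := sum_signs_contracted_linear_le y w θ B H hB hw
    (fun i s => -clippedLoss ⟪w s, y i⟫) (fun i s t => by
      rw [neg_sub_neg, abs_sub_comm]; exact abs_clippedLoss_sub_le _ _) t
  have hsplit : ∀ σ : Fin m → Bool, ∑ i, boolSign (σ i) *
        (clippedLoss ⟪w (t σ), y' i⟫ - clippedLoss ⟪w (t σ), y i⟫)
        + θ (t σ) * Real.sqrt (∑ i, (e i ^ 2 + e' i ^ 2))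
      = (θ (t σ) * H + ∑ i, boolSign (σ i) * clippedLoss ⟪w (t σ), y' i⟫)
        + (θ (t σ) * H + ∑ i, boolSign (σ i) * -clippedLoss ⟪w (t σ), y i⟫) := fun σ => by
    simp only [mul_sub, mul_neg, Finset.sum_sub_distrib, Finset.sum_neg_distrib]
    rw [hH]; ring
  rw [Finset.sum_congr rfl fun σ _ => hsplit σ, Finset.sum_add_distrib]
  refine (add_le_add h1 h2).trans ?_
  rw [← mul_add, ← mul_add, mul_comm 2 B, mul_assoc]
  refine mul_le_mul_of_nonneg_left (mul_le_mul_of_nonneg_left ?_ hB) (by positivity)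
  set a := ∑ i, ‖y' i‖ ^ 2 + H ^ 2 with ha
  set b := ∑ i, ‖y i‖ ^ 2 + H ^ 2 with hb
  have ha0 : 0 ≤ a := by positivity
  have hb0 : 0 ≤ b := by positivity
  have hab : a + b ≤ 2 * (m * u ^ 2) := by
    have h3 := Finset.sum_le_sum (s := Finset.univ) fun i _ => hy i
    have h4 := Finset.sum_le_sum (s := Finset.univ) fun i _ => hy' i
    have h5 : 0 ≤ ∑ i, e i ^ 2 := by positivity
    have h6 : 0 ≤ ∑ i, e' i ^ 2 := by positivity
    simp only [Finset.sum_add_distrib, Finset.sum_const, Finset.card_univ, Fintype.card_fin,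
      nsmul_eq_mul] at h3 h4 hH2
    rw [ha, hb, hH2]
    linarith
  refine abs_le_of_sq_le_sq' ?_ (by positivity) |>.2
  rw [mul_pow, Real.sq_sqrt (by positivity)]
  nlinarith [Real.sq_sqrt ha0, Real.sq_sqrt hb0, sq_nonneg (Real.sqrt a - Real.sqrt b)]

theorem le_iSup_of_abs_le {ι : Type*} {f : ι → ℝ} {C : ℝ} (h : ∀ i, |f i| ≤ C) (i : ι) :
    f i ≤ ⨆ j, f j :=
  le_ciSup (f := f) ⟨C, by rintro _ ⟨i, rfl⟩; exact (abs_le.1 (h i)).2⟩ i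

theorem abs_sum_sub_le {m : ℕ} {a b : Fin m → ℝ} (ha : ∀ i, 0 ≤ a i) (ha1 : ∀ i, a i ≤ 1)
    (hb : ∀ i, 0 ≤ b i) (hb1 : ∀ i, b i ≤ 1) : |∑ i, (a i - b i)| ≤ m := by
  refine (Finset.abs_sum_le_sum_abs _ _).trans ((Finset.sum_le_sum fun i _ =>
    abs_le.2 ⟨?_, ?_⟩ : _ ≤ ∑ _i : Fin m, (1 : ℝ)).trans (by simp))
  · linarith [ha i, hb1 i]
  · linarith [ha1 i, hb i]

/-- Exchanging the two entries of the pairs not selected by `σ` preserves the law of a sample of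
independent pairs. -/
theorem measurePreserving_swap_pairs {Z : Type*} [MeasurableSpace Z] (P : Measure Z)
    [IsProbabilityMeasure P] {m : ℕ} (σ : Fin m → Bool) :
    MeasurePreserving (fun (p : Fin m → Z × Z) i => if σ i then p i else (p i).swap)
      (Measure.pi fun _ => P.prod P) (Measure.pi fun _ => P.prod P) := by
  refine measurePreserving_pi (fun _ => P.prod P) (fun _ => P.prod P)
    (f := fun i q => if σ i then q else q.swap) fun i => ?_
  cases σ i
  · simpa using Measure.measurePreserving_swap
  · simp only [if_true]
    exact MeasurePreserving.id _

theorem measurable_iSup_deviation {Z E : Type*} [MeasurableSpace Z] [NormedAddCommGroup E]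
    [InnerProductSpace ℝ E] [MeasurableSpace E] [BorelSpace E] (Y : Z → E) (hY : Measurable Y)
    (η : Z → ℝ) (hη : Measurable η) {m : ℕ} (a : ℕ → ℝ) (w : ℕ → E) (c : ℕ → Fin m → ℝ) :
    Measurable fun S : Fin m → Z =>
      ⨆ n, ∑ i, (a n - clippedLoss (⟪w n, Y (S i)⟫ + c n i * η (S i))) := by
  refine Measurable.iSup fun n => Finset.measurable_sum _ fun i _ => ?_
  have : Measurable fun z => ⟪w n, Y z⟫ :=
    (continuous_const.inner continuous_id : Continuous fun x => ⟪w n, x⟫).measurable.comp hY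
  have h2 : Measurable fun z => ⟪w n, Y z⟫ + c n i * η z := this.add (hη.const_mul _)
  exact ((continuous_clippedLoss.measurable.comp h2).comp (measurable_pi_apply i)).const_sub _

/-- Expected uniform deviation between the mean clipped loss of a linear function and the clipped
loss on a sample, when the `i`-th sample value may in addition be perturbed by `cᵢ η`. -/
theorem integral_iSup_deviation_le {Z E : Type*} [MeasurableSpace Z] (P : Measure Z)
    [IsProbabilityMeasure P] [NormedAddCommGroup E] [InnerProductSpace ℝ E] [MeasurableSpace E]
    [BorelSpace E] (Y : Z → E) (hY : Measurable Y) (η : Z → ℝ)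
    (hη : Measurable η) (u : ℝ) (hu : ∀ z, ‖Y z‖ ^ 2 + η z ^ 2 ≤ u ^ 2)
    (m : ℕ) (B : ℝ) (hB : 0 ≤ B) (w : ℕ → E) (c : ℕ → Fin m → ℝ)
    (hwc : ∀ n, ‖w n‖ ^ 2 + ∑ i, c n i ^ 2 ≤ B ^ 2) :
    ∫ S, (⨆ n, ∑ i, ((∫ z, clippedLoss ⟪w n, Y z⟫ ∂P)
        - clippedLoss (⟪w n, Y (S i)⟫ + c n i * η (S i)))) ∂(Measure.pi fun _ : Fin m => P)
      ≤ 2 * B * Real.sqrt (m * u ^ 2) := by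
  set ν : Measure (Fin m → Z) := Measure.pi fun _ => P with hν
  set π : Measure (Fin m → Z × Z) := Measure.pi fun _ => P.prod P with hπ
  set a : ℕ → ℝ := fun n => ∫ z, clippedLoss ⟪w n, Y z⟫ ∂P with ha
  set g : ℕ → Z → ℝ := fun n z => clippedLoss ⟪w n, Y z⟫ with hg
  have hgm : ∀ n, Measurable (g n) := fun n => by
    have : Measurable fun z => ⟪w n, Y z⟫ :=
      (continuous_const.inner continuous_id : Continuous fun x => ⟪w n, x⟫).measurable.comp hY
    exact continuous_clippedLoss.measurable.comp this
  have hg0 : ∀ n z, 0 ≤ g n z := fun n z => clippedLoss_nonneg _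
  have hg1 : ∀ n z, g n z ≤ 1 := fun n z => clippedLoss_le_one _
  have hgi : ∀ n, Integrable (g n) P := fun n =>
    integrable_of_abs_le (hgm n) (C := 1) fun z => abs_le.2 ⟨by linarith [hg0 n z], hg1 n z⟩
  have ha0 : ∀ n, 0 ≤ a n := fun n => integral_nonneg (hg0 n)
  have ha1 : ∀ n, a n ≤ 1 := fun n => by
    have := integral_mono (hgi n) (integrable_const (1 : ℝ)) (hg1 n)
    simpa using this
  set θ : ℕ → ℝ := fun n => Real.sqrt (∑ i, c n i ^ 2) with hθ
  have hθ2 : ∀ n, θ n ^ 2 = ∑ i, c n i ^ 2 := fun n => Real.sq_sqrt (by positivity)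
  have hθB : ∀ n, θ n ≤ B := fun n => by
    refine abs_le_of_sq_le_sq' ?_ hB |>.2
    rw [hθ2]; linarith [hwc n, sq_nonneg ‖w n‖]
  have hθ0 : ∀ n, 0 ≤ θ n := fun n => Real.sqrt_nonneg _
  have hηu : ∀ z, η z ^ 2 ≤ u ^ 2 := fun z => by linarith [hu z, sq_nonneg ‖Y z‖]
  set H : (Fin m → Z × Z) → ℝ := fun p => Real.sqrt (∑ i, (η (p i).1 ^ 2 + η (p i).2 ^ 2)) with hH
  have hH0 : ∀ p, 0 ≤ H p := fun p => Real.sqrt_nonneg _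
  have hHle : ∀ p, H p ≤ Real.sqrt (m * (2 * u ^ 2)) := fun p => by
    refine Real.sqrt_le_sqrt ((Finset.sum_le_sum fun i _ =>
      (by linarith [hηu (p i).1, hηu (p i).2] : _ ≤ 2 * u ^ 2)).trans (by simp))
  set q : ℕ → (Fin m → Z × Z) → ℝ := fun n p =>
    ∑ i, (g n (p i).2 - g n (p i).1) + θ n * H p with hq
  set C : ℝ := m + B * Real.sqrt (m * (2 * u ^ 2)) with hC
  have hqC : ∀ n p, |q n p| ≤ C := fun n p => by
    refine (abs_add_le _ _).trans (add_le_add (abs_sum_sub_le (fun _ => hg0 _ _) (fun _ => hg1 _ _)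
      (fun _ => hg0 _ _) (fun _ => hg1 _ _)) ?_)
    rw [abs_of_nonneg (mul_nonneg (hθ0 n) (hH0 p))]
    exact mul_le_mul (hθB n) (hHle p) (hH0 p) hB
  have hHm : Measurable H := by
    refine Real.continuous_sqrt.measurable.comp (Finset.measurable_sum _ fun i _ => ?_)
    fun_prop
  have hqm : ∀ n, Measurable (q n) := fun n => by
    refine Measurable.add (Finset.measurable_sum _ fun i _ => ?_) (hHm.const_mul _)
    exact ((hgm n).comp (by fun_prop)).sub ((hgm n).comp (by fun_prop))
  set Q : (Fin m → Z × Z) → ℝ := fun p => ⨆ n, q n p with hQ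
  have hQm : Measurable Q := Measurable.iSup hqm
  have hQC : ∀ p, |Q p| ≤ C := fun p => abs_iSup_le fun n => hqC n p
  have hQi : Integrable Q π := integrable_of_abs_le hQm hQC
  -- symmetrization
  have hpair : Measurable fun r : (Fin m → Z) × (Fin m → Z) => fun i => (r.1 i, r.2 i) := by
    fun_prop
  have hQprod : ∫ p, Q p ∂π = ∫ S, ∫ S', Q (fun i => (S i, S' i)) ∂ν ∂ν := by
    rw [← integral_prod (fun r : (Fin m → Z) × (Fin m → Z) => Q fun i => (r.1 i, r.2 i))
      (integrable_of_abs_le (hQm.comp hpair) fun _ => hQC _)]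
    have h := (measurePreserving_arrowProdEquivProdArrow Z Z (Fin m) (fun _ => P)
      (fun _ => P)).symm
    exact (h.integral_comp' (g := Q)).symm
  have hghost : ∀ S : Fin m → Z, (⨆ n, ∑ i, (a n - clippedLoss (⟪w n, Y (S i)⟫ + c n i * η (S i))))
      ≤ ∫ S', Q (fun i => (S i, S' i)) ∂ν := fun S => by
    refine ciSup_le fun n => ?_
    have hmS : Measurable fun S' : Fin m → Z => fun i => (S i, S' i) := by fun_prop
    have hev : ∀ i, ∫ S', g n (S' i) ∂ν = a n := fun i => by
      have h := measurePreserving_eval (fun _ : Fin m => P) i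
      have h' := integral_map (μ := ν) h.measurable.aemeasurable (f := g n)
        (hgm n).aestronglyMeasurable
      rw [h.map_eq] at h'
      exact h'.symm
    have hevi : ∀ i, Integrable (fun S' : Fin m → Z => g n (S' i)) ν := fun i =>
      integrable_of_abs_le ((hgm n).comp (measurable_pi_apply i)) (C := 1) fun S' =>
        abs_le.2 ⟨by linarith [hg0 n (S' i)], hg1 n (S' i)⟩
    have hsubi : ∀ i, Integrable (fun S' : Fin m → Z => g n (S' i) - g n (S i)) ν := fun i =>
      (hevi i).sub (integrable_const _)
    have h1 : ∑ i, (a n - clippedLoss (⟪w n, Y (S i)⟫ + c n i * η (S i)))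
        ≤ ∑ i, (a n - g n (S i)) + θ n * Real.sqrt (∑ i, η (S i) ^ 2) := by
      have h2 : ∑ i, |c n i| * |η (S i)| ≤ θ n * Real.sqrt (∑ i, η (S i) ^ 2) := by
        have := Real.sum_mul_le_sqrt_mul_sqrt Finset.univ (fun i => |c n i|) fun i => |η (S i)|
        simpa only [sq_abs] using this
      have h3 : ∑ i, (a n - clippedLoss (⟪w n, Y (S i)⟫ + c n i * η (S i)))
          ≤ ∑ i, ((a n - g n (S i)) + |c n i| * |η (S i)|) := Finset.sum_le_sum fun i _ => by
        have := abs_clippedLoss_sub_le (⟪w n, Y (S i)⟫) (⟪w n, Y (S i)⟫ + c n i * η (S i))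
        rw [sub_add_cancel_left, abs_neg, abs_mul] at this
        have := (abs_le.1 this).2
        simp only [hg]
        linarith
      rw [Finset.sum_add_distrib] at h3
      linarith
    have h2 : ∑ i, (a n - g n (S i)) + θ n * Real.sqrt (∑ i, η (S i) ^ 2)
        = ∫ S', (∑ i, (g n (S' i) - g n (S i)) + θ n * Real.sqrt (∑ i, η (S i) ^ 2)) ∂ν := by
      rw [integral_add (integrable_finsetSum _ fun i _ => hsubi i)
        (integrable_const _), integral_finsetSum _ fun i _ => hsubi i]
      congr 1
      · refine Finset.sum_congr rfl fun i _ => ?_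
        rw [integral_sub (hevi i) (integrable_const _), hev]
        simp
      · simp
    refine h1.trans (h2.le.trans (integral_mono ?_ ?_ fun S' => ?_))
    · exact (integrable_finsetSum _ fun i _ => hsubi i).add
        (integrable_const _)
    · exact integrable_of_abs_le (hQm.comp hmS) fun _ => hQC _
    · refine le_trans ?_ (le_iSup_of_abs_le (f := fun n => q n fun i => (S i, S' i))
        (fun n => hqC n _) n)
      refine add_le_add le_rfl (mul_le_mul_of_nonneg_left (Real.sqrt_le_sqrt ?_) (hθ0 n))
      exact Finset.sum_le_sum fun i _ => by simp only; linarith [sq_nonneg (η (S' i))]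
  have hstep1 : ∫ S, (⨆ n, ∑ i, (a n - clippedLoss (⟪w n, Y (S i)⟫ + c n i * η (S i)))) ∂ν
      ≤ ∫ p, Q p ∂π := by
    rw [hQprod]
    have hJi : Integrable (fun S => ∫ S', Q (fun i => (S i, S' i)) ∂ν) ν :=
      (integrable_of_abs_le (hQm.comp hpair) (μ := ν.prod ν) fun _ => hQC _).integral_prod_left
    exact integral_mono (integrable_of_abs_le (measurable_iSup_deviation Y hY η hη a w c)
      fun S => abs_iSup_le fun n => abs_sum_sub_le (fun _ => ha0 n) (fun _ => ha1 n)
        (fun _ => clippedLoss_nonneg _) fun _ => clippedLoss_le_one _) hJi hghost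
  refine hstep1.trans ?_
  -- averaging over swaps
  have hswap : ∀ σ : Fin m → Bool,
      ∫ p, Q (fun i => if σ i then p i else (p i).swap) ∂π = ∫ p, Q p ∂π := fun σ => by
    have h := measurePreserving_swap_pairs P σ
    conv_rhs => rw [hπ, ← h.map_eq]
    rw [integral_map h.measurable.aemeasurable hQm.aestronglyMeasurable]
  have hswapi : ∀ σ : Fin m → Bool,
      Integrable (fun p => Q (fun i => if σ i then p i else (p i).swap)) π := fun σ =>
    integrable_of_abs_le (hQm.comp (measurePreserving_swap_pairs P σ).measurable) fun _ => hQC _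
  have hpt : ∀ p : Fin m → Z × Z, ∑ σ : Fin m → Bool, Q (fun i => if σ i then p i else (p i).swap)
      ≤ 2 ^ m * (2 * B * Real.sqrt (m * u ^ 2)) := fun p => by
    refine le_trans (le_of_eq (Finset.sum_congr rfl fun σ _ => ?_))
      (sum_signs_iSup_le (fun i => Y (p i).1) (fun i => Y (p i).2) (fun i => η (p i).1)
        (fun i => η (p i).2) u (fun i => hu _) (fun i => hu _) w θ B hB
        fun n => by rw [hθ2]; exact hwc n)
    refine iSup_congr fun n => ?_
    simp only [hq, hH]
    congr 1
    · refine Finset.sum_congr rfl fun i _ => ?_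
      cases σ i <;> simp [boolSign_true, boolSign_false, hg]
    · congr 2
      refine Finset.sum_congr rfl fun i _ => ?_
      cases σ i <;> simp [add_comm]
  have hsum : (2 : ℝ) ^ m * ∫ p, Q p ∂π
      = ∫ p, ∑ σ : Fin m → Bool, Q (fun i => if σ i then p i else (p i).swap) ∂π := by
    rw [integral_finsetSum _ fun σ _ => hswapi σ, Finset.sum_congr rfl fun σ _ => hswap σ]
    simp
  have hfin := integral_mono (integrable_finsetSum Finset.univ fun σ _ => hswapi σ)
    (integrable_const (μ := π) (2 ^ m * (2 * B * Real.sqrt (m * u ^ 2)))) hpt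
  rw [← hsum] at hfin
  simp only [integral_const, probReal_univ, smul_eq_mul, one_mul] at hfin
  exact le_of_mul_le_mul_left hfin (by positivity)

theorem measurable_clippedLoss_inner {Z E : Type*} [MeasurableSpace Z] [NormedAddCommGroup E]
    [InnerProductSpace ℝ E] [MeasurableSpace E] [BorelSpace E] {Y : Z → E} (hY : Measurable Y)
    (w : E) : Measurable fun z => clippedLoss ⟪w, Y z⟫ :=
  (continuous_clippedLoss.comp (continuous_const.inner continuous_id) :
    Continuous fun x => clippedLoss ⟪w, x⟫).measurable.comp hY

theorem integrable_clippedLoss_inner {Z E : Type*} [MeasurableSpace Z] (P : Measure Z)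
    [IsProbabilityMeasure P] [NormedAddCommGroup E]
    [InnerProductSpace ℝ E] [MeasurableSpace E] [BorelSpace E] {Y : Z → E} (hY : Measurable Y)
    (w : E) : Integrable (fun z => clippedLoss ⟪w, Y z⟫) P :=
  integrable_of_abs_le (measurable_clippedLoss_inner hY w) (C := 1) fun z =>
    abs_le.2 ⟨by linarith [clippedLoss_nonneg ⟪w, Y z⟫], clippedLoss_le_one _⟩

theorem continuous_integral_clippedLoss_inner {Z E : Type*} [MeasurableSpace Z] (P : Measure Z)
    [IsProbabilityMeasure P] [NormedAddCommGroup E]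
    [InnerProductSpace ℝ E] [SecondCountableTopology E] [MeasurableSpace E] [BorelSpace E]
    {Y : Z → E} (hY : Measurable Y) :
    Continuous fun w : E => ∫ z, clippedLoss ⟪w, Y z⟫ ∂P := by
  refine continuous_of_dominated (bound := fun _ => 1)
    (fun w => (measurable_clippedLoss_inner hY w).aestronglyMeasurable) (fun w => ?_)
    (integrable_const _) (Filter.Eventually.of_forall fun z => ?_)
  · refine Filter.Eventually.of_forall fun z => ?_
    rw [Real.norm_eq_abs, abs_of_nonneg (clippedLoss_nonneg _)]
    exact clippedLoss_le_one _
  · exact continuous_clippedLoss.comp (continuous_id.inner continuous_const)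

theorem integral_clippedLoss_inner_mem {Z E : Type*} [MeasurableSpace Z] (P : Measure Z)
    [IsProbabilityMeasure P] [NormedAddCommGroup E] [InnerProductSpace ℝ E]
    [MeasurableSpace E] [BorelSpace E] {Y : Z → E} (hY : Measurable Y) (w : E) :
    0 ≤ ∫ z, clippedLoss ⟪w, Y z⟫ ∂P ∧ ∫ z, clippedLoss ⟪w, Y z⟫ ∂P ≤ 1 := by
  refine ⟨integral_nonneg fun z => clippedLoss_nonneg _, ?_⟩
  have := integral_mono (integrable_clippedLoss_inner P hY w) (integrable_const (1 : ℝ))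
    fun z => clippedLoss_le_one _
  simpa using this

/-- Uniform deviation bound, with probability at least `1 - exp (-2 m ε²)`, for linear functions on
a separable inner product space whose sample values are perturbed by an additional `ℓ²` term. -/
theorem exists_measurableSet_uniform_deviation {Z E : Type*} [MeasurableSpace Z] (P : Measure Z)
    [IsProbabilityMeasure P] [NormedAddCommGroup E] [InnerProductSpace ℝ E]
    [SecondCountableTopology E] [MeasurableSpace E] [BorelSpace E] (Y : Z → E) (hY : Measurable Y)
    (η : Z → ℝ) (hη : Measurable η) (u : ℝ) (hu : ∀ z, ‖Y z‖ ^ 2 + η z ^ 2 ≤ u ^ 2)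
    (m : ℕ) (B : ℝ) (hB : 0 ≤ B) (ε : ℝ) (hε : 0 ≤ ε) :
    ∃ A : Set (Fin m → Z), MeasurableSet A ∧
      (Measure.pi fun _ => P) A ≤ ENNReal.ofReal (Real.exp (-2 * m * ε ^ 2)) ∧
      ∀ S ∉ A, ∀ (w : E) (c : Fin m → ℝ), ‖w‖ ^ 2 + ∑ i, c i ^ 2 ≤ B ^ 2 →
        ∑ i, ((∫ z, clippedLoss ⟪w, Y z⟫ ∂P) - clippedLoss (⟪w, Y (S i)⟫ + c i * η (S i)))
          ≤ 2 * B * Real.sqrt (m * u ^ 2) + m * ε := by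
  let T := {p : E × (Fin m → ℝ) // ‖p.1‖ ^ 2 + ∑ i, p.2 i ^ 2 ≤ B ^ 2}
  have : Nonempty T := ⟨⟨0, by simpa using sq_nonneg B⟩⟩
  let d : ℕ → T := TopologicalSpace.denseSeq T
  let D : (Fin m → Z) → ℝ := fun S => ⨆ n, ∑ i, ((∫ z, clippedLoss ⟪(d n).1.1, Y z⟫ ∂P)
    - clippedLoss (⟪(d n).1.1, Y (S i)⟫ + (d n).1.2 i * η (S i)))
  have hbd : ∀ (S : Fin m → Z) n, |∑ i, ((∫ z, clippedLoss ⟪(d n).1.1, Y z⟫ ∂P)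
      - clippedLoss (⟪(d n).1.1, Y (S i)⟫ + (d n).1.2 i * η (S i)))| ≤ m := fun S n =>
    abs_sum_sub_le (fun _ => (integral_clippedLoss_inner_mem P hY _).1)
      (fun _ => (integral_clippedLoss_inner_mem P hY _).2)
      (fun _ => clippedLoss_nonneg _) fun _ => clippedLoss_le_one _
  have hDm : Measurable D := measurable_iSup_deviation Y hY η hη _ _ _
  have hDC : ∀ S, |D S| ≤ m := fun S => abs_iSup_le (hbd S)
  have hDd : ∀ S i z, D (Function.update S i z) - D S ≤ 1 := fun S i z => by
    rw [sub_le_iff_le_add]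
    refine ciSup_le fun n => le_trans ?_ (add_le_add_right (le_iSup_of_abs_le (hbd S) n) 1)
    rw [← Finset.add_sum_erase _ _ (Finset.mem_univ i),
      ← Finset.add_sum_erase Finset.univ (fun j => ((∫ z, clippedLoss ⟪(d n).1.1, Y z⟫ ∂P)
      - clippedLoss (⟪(d n).1.1, Y (S j)⟫ + (d n).1.2 j * η (S j)))) (Finset.mem_univ i)]
    have h : ∀ j ∈ Finset.univ.erase i, ((∫ z, clippedLoss ⟪(d n).1.1, Y z⟫ ∂P)
        - clippedLoss (⟪(d n).1.1, Y (Function.update S i z j)⟫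
          + (d n).1.2 j * η (Function.update S i z j)))
        = ((∫ z, clippedLoss ⟪(d n).1.1, Y z⟫ ∂P)
        - clippedLoss (⟪(d n).1.1, Y (S j)⟫ + (d n).1.2 j * η (S j))) := fun j hj => by
      rw [Function.update_of_ne (Finset.ne_of_mem_erase hj)]
    rw [Finset.sum_congr rfl h]
    have h1 := clippedLoss_nonneg (⟪(d n).1.1, Y (Function.update S i z i)⟫
      + (d n).1.2 i * η (Function.update S i z i))
    have h2 := clippedLoss_le_one (⟪(d n).1.1, Y (S i)⟫ + (d n).1.2 i * η (S i))
    linarith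
  have hint := integral_iSup_deviation_le P Y hY η hη u hu m B hB (fun n => (d n).1.1)
    (fun n => (d n).1.2) fun n => (d n).2
  refine ⟨{S | m * ε ≤ D S - ∫ T, D T ∂Measure.pi fun _ => P},
    measurableSet_le measurable_const (hDm.sub_const _),
    measure_ge_le_of_bounded_differences P m D hDm m hDC hDd ε hε, fun S hS w c hwc => ?_⟩
  rw [Set.mem_ofPred_eq, not_le] at hS
  have hcont : Continuous fun t : T => ∑ i, ((∫ z, clippedLoss ⟪t.1.1, Y z⟫ ∂P)
      - clippedLoss (⟪t.1.1, Y (S i)⟫ + t.1.2 i * η (S i))) := by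
    refine continuous_finsetSum _ fun i _ => ?_
    refine ((continuous_integral_clippedLoss_inner P hY).comp
      (continuous_fst.comp continuous_subtype_val)).sub (continuous_clippedLoss.comp ?_)
    refine Continuous.add ?_ ?_
    · exact (continuous_fst.comp continuous_subtype_val).inner continuous_const
    · exact (((continuous_apply i).comp
        (continuous_snd.comp continuous_subtype_val))).mul continuous_const
  have hdense : ∀ t : T, t ∈ {t : T | ∑ i, ((∫ z, clippedLoss ⟪t.1.1, Y z⟫ ∂P)
      - clippedLoss (⟪t.1.1, Y (S i)⟫ + t.1.2 i * η (S i))) ≤ D S} := by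
    have hcl := isClosed_le hcont (continuous_const (y := D S))
    intro t
    refine hcl.closure_subset_iff.2 ?_ (TopologicalSpace.denseRange_denseSeq T t)
    rintro _ ⟨n, rfl⟩
    exact le_iSup_of_abs_le (hbd S) n
  have := hdense ⟨(w, c), hwc⟩
  simp only [Set.mem_ofPred_eq] at this
  simp only [D] at hS this
  linarith

/-- A measurable set of samples each of which has two distinct entries related by `N` is null as
soon as almost every point is unrelated to any given one. `N` need not be measurable. -/
theorem measure_pi_eq_zero_of_exists_rel {Z : Type*} [MeasurableSpace Z] (P : Measure Z)
    [IsProbabilityMeasure P] (N : Z → Z → Prop) (hsymm : ∀ z z', N z z' → N z' z)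
    (hN : ∀ z, ∀ᵐ z' ∂P, ¬ N z z') (m : ℕ) (A : Set (Fin m → Z)) (hA : MeasurableSet A)
    (hsub : ∀ S ∈ A, ∃ i j, i ≠ j ∧ N (S i) (S j)) : (Measure.pi fun _ => P) A = 0 := by
  induction m with
  | zero =>
    have : A = ∅ := Set.eq_empty_of_forall_notMem fun S hS => by
      obtain ⟨i, -⟩ := hsub S hS
      exact i.elim0
    simp [this]
  | succ m ih =>
    have h := measurePreserving_finCons P m
    rw [← h.measure_preimage hA.nullMeasurableSet,
      Measure.prod_apply (h.measurable hA)]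
    refine lintegral_eq_zero_of_ae_eq_zero (Filter.Eventually.of_forall fun z => ?_)
    set B : Set (Fin m → Z) := Prod.mk z ⁻¹'
      ((fun p : Z × (Fin m → Z) => (Fin.cons p.1 p.2 : Fin (m + 1) → Z)) ⁻¹' A) with hB
    have hBm : MeasurableSet B := measurable_prodMk_left (h.measurable hA)
    set T : Set (Fin m → Z) := {S | ∃ i, N z (S i)} with hT
    have hT0 : (Measure.pi fun _ : Fin m => P) T = 0 := by
      have : ∀ᵐ S ∂(Measure.pi fun _ : Fin m => P), ∀ i, ¬ N z (S i) := ae_all_iff.2 fun i =>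
        (measurePreserving_eval (fun _ : Fin m => P) i).quasiMeasurePreserving.ae (hN z)
      refine measure_mono_null (fun S hS => ?_) (ae_iff.1 this)
      simpa [hT] using hS
    have hdiff := ih (B \ toMeasurable (Measure.pi fun _ => P) T)
      (hBm.diff (measurableSet_toMeasurable _ _)) fun S hS => by
        obtain ⟨i, j, hij, hNij⟩ := hsub _ hS.1
        have hST : ∀ i, ¬ N z (S i) := fun i hi => hS.2 (subset_toMeasurable _ _ ⟨i, hi⟩)
        induction i using Fin.cases with
        | zero =>
          induction j using Fin.cases with
          | zero => exact absurd rfl hij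
          | succ j => exact absurd hNij (hST j)
        | succ i =>
          induction j using Fin.cases with
          | zero => exact absurd (hsymm _ _ hNij) (hST i)
          | succ j => exact ⟨i, j, fun h => hij (h ▸ rfl), hNij⟩
    refine measure_mono_null (t := (B \ toMeasurable (Measure.pi fun _ => P) T)
      ∪ toMeasurable (Measure.pi fun _ => P) T) (fun S hS => ?_)
      (measure_union_null hdiff (by rw [measure_toMeasurable, hT0]))
    by_cases hST : S ∈ toMeasurable (Measure.pi fun _ => P) T
    exacts [Or.inr hST, Or.inl ⟨hS, hST⟩]

/-- A bounded measurable map into a Hilbert space is weakly concentrated on a separable closed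
subspace. -/
theorem exists_isSeparable_ae_inner_eq_zero {Z 𝓗 : Type*} [MeasurableSpace Z] (P : Measure Z)
    [IsProbabilityMeasure P] [NormedAddCommGroup 𝓗] [InnerProductSpace ℝ 𝓗] [CompleteSpace 𝓗]
    [MeasurableSpace 𝓗] [BorelSpace 𝓗] (Y : Z → 𝓗) (hY : Measurable Y) (u : ℝ)
    (hu : ∀ z, ‖Y z‖ ^ 2 ≤ u ^ 2) :
    ∃ K : Submodule ℝ 𝓗, IsClosed (K : Set 𝓗) ∧ TopologicalSpace.IsSeparable (K : Set 𝓗) ∧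
      ∀ w ∈ Kᗮ, ∀ᵐ z ∂P, ⟪w, Y z⟫ = 0 := by
  obtain ⟨ι, b, -⟩ := exists_hilbertBasis ℝ 𝓗
  have hm : ∀ w, Measurable fun z => ⟪w, Y z⟫ := fun w =>
    (continuous_const.inner continuous_id : Continuous fun x => ⟪w, x⟫).measurable.comp hY
  have hle : ∀ (s : Finset ι) z, ∑ i ∈ s, ⟪b i, Y z⟫ ^ 2 ≤ u ^ 2 := fun s z => by
    have := b.orthonormal.sum_inner_products_le (Y z) (s := s)
    simp only [Real.norm_eq_abs, sq_abs] at this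
    exact this.trans (hu z)
  have hi : ∀ i, Integrable (fun z => ⟪b i, Y z⟫ ^ 2) P := fun i =>
    integrable_of_abs_le ((hm _).pow_const 2) (C := u ^ 2) fun z => by
      rw [abs_of_nonneg (sq_nonneg _)]
      simpa using hle {i} z
  have hsum : Summable fun i => ∫ z, ⟪b i, Y z⟫ ^ 2 ∂P := by
    refine summable_of_sum_le (c := u ^ 2) (fun i => integral_nonneg fun z => sq_nonneg _)
      fun s => ?_
    rw [← integral_finsetSum _ fun i _ => hi i]
    have := integral_mono (integrable_finsetSum s fun i _ => hi i) (integrable_const (u ^ 2))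
      (hle s)
    simpa using this
  have hcount := hsum.countable_support
  set I := Function.support fun i => ∫ z, ⟪b i, Y z⟫ ^ 2 ∂P with hI
  set K := (Submodule.span ℝ (b '' I)).topologicalClosure with hK
  refine ⟨K, Submodule.isClosed_topologicalClosure _, ?_, fun w hw => ?_⟩
  · rw [hK, Submodule.topologicalClosure_coe]
    exact ((hcount.image b).isSeparable.span).closure
  have hw0 : ∀ i ∈ I, ⟪w, b i⟫ = 0 := fun i hi =>
    (K.mem_orthogonal' w).1 hw _ (Submodule.le_topologicalClosure _
      (Submodule.subset_span ⟨i, hi, rfl⟩))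
  have hwc : (Function.support fun i => ‖⟪b i, w⟫‖ ^ 2).Countable :=
    (b.orthonormal.inner_products_summable w).countable_support
  have hae : ∀ᵐ z ∂P, ∀ i ∈ Function.support fun i => ‖⟪b i, w⟫‖ ^ 2,
      i ∉ I → ⟪b i, Y z⟫ = 0 := by
    refine (ae_ball_iff hwc).2 fun i _ => ?_
    by_cases hiI : i ∈ I
    · exact Filter.Eventually.of_forall fun z h => absurd hiI h
    have h0 : ∫ z, ⟪b i, Y z⟫ ^ 2 ∂P = 0 := by simpa [hI] using hiI
    have := (integral_eq_zero_iff_of_nonneg (fun z => sq_nonneg _) (hi i)).1 h0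
    filter_upwards [this] with z hz _
    simpa using hz
  filter_upwards [hae] with z hz
  rw [← (b.hasSum_inner_mul_inner w (Y z)).tsum_eq]
  refine (tsum_congr fun i => ?_).trans tsum_zero
  by_cases hiI : i ∈ I
  · rw [hw0 i hiI, zero_mul]
  · by_cases hs : ⟪b i, w⟫ = 0
    · rw [real_inner_comm, hs, zero_mul]
    · rw [hz i (by simpa using hs) hiI, mul_zero]

/-- The Bessel inequality for a pairwise orthogonal finite family, together with the recovery of the
inner products from the normalized coefficients. -/
theorem exists_coefficients_of_orthogonal {𝓗 : Type*} [NormedAddCommGroup 𝓗]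
    [InnerProductSpace ℝ 𝓗] {m : ℕ} (y : Fin m → 𝓗) (hy : ∀ i j, i ≠ j → ⟪y i, y j⟫ = 0) (w : 𝓗) :
    ∃ c : Fin m → ℝ, ∑ i, c i ^ 2 ≤ ‖w‖ ^ 2 ∧ ∀ i, ⟪w, y i⟫ = c i * ‖y i‖ := by
  let c : Fin m → ℝ := fun i => ⟪w, y i⟫ / ‖y i‖
  refine ⟨c, ?_, fun i => ?_⟩
  · let e : {i // y i ≠ 0} → 𝓗 := fun i => (‖y i.1‖)⁻¹ • y i.1
    have he : Orthonormal ℝ e := by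
      refine ⟨fun i => ?_, fun i j hij => ?_⟩
      · simp only [e]
        rw [norm_smul, norm_inv, norm_norm, inv_mul_cancel₀ (norm_ne_zero_iff.2 i.2)]
      · simp only [e]
        rw [real_inner_smul_left, real_inner_smul_right, hy _ _ fun h => hij (Subtype.ext h)]
        simp
    classical
    have h := he.sum_inner_products_le w (s := Finset.univ)
    refine le_trans (le_of_eq ?_) h
    rw [← Finset.sum_filter_of_ne (p := fun i => y i ≠ 0) fun i _ hi h0 => hi (by simp [c, h0]),
      Finset.sum_subtype (p := fun i => y i ≠ 0) _ (by simp)]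
    refine Finset.sum_congr rfl fun i _ => ?_
    simp only [e, c]
    rw [real_inner_smul_left, Real.norm_eq_abs, sq_abs, real_inner_comm, div_eq_inv_mul]
  · simp only [c]
    by_cases h : y i = 0
    · simp [h]
    · rw [div_mul_cancel₀ _ (norm_ne_zero_iff.2 h)]

/-- Uniform deviation bounds at countably many radii hold simultaneously with probability at least
`1 - δ`, without any separability assumption on the Hilbert space. -/
theorem ofReal_le_measure_of_uniform_deviation {Z 𝓗 : Type*} [MeasurableSpace Z] (P : Measure Z)
    [IsProbabilityMeasure P] [NormedAddCommGroup 𝓗] [InnerProductSpace ℝ 𝓗] [CompleteSpace 𝓗]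
    [MeasurableSpace 𝓗] [BorelSpace 𝓗] (Y : Z → 𝓗) (hY : Measurable Y) (u : ℝ)
    (hu : ∀ z, ‖Y z‖ ^ 2 ≤ u ^ 2) (m : ℕ) (B ε : ℕ → ℝ) (hB : ∀ k, 0 ≤ B k) (hε : ∀ k, 0 ≤ ε k)
    (δ : ℝ) (hδ0 : 0 ≤ δ)
    (hδ : ∑' k, ENNReal.ofReal (Real.exp (-2 * m * ε k ^ 2)) ≤ ENNReal.ofReal δ)
    (A : Set (Fin m → Z))
    (hA : ∀ S : Fin m → Z, (∀ k w, ‖w‖ ≤ B k →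
      ∑ i, ((∫ z, clippedLoss ⟪w, Y z⟫ ∂P) - clippedLoss ⟪w, Y (S i)⟫)
        ≤ 2 * B k * Real.sqrt (m * u ^ 2) + m * ε k) → S ∈ A) :
    ENNReal.ofReal (1 - δ) ≤ (Measure.pi fun _ => P) A := by
  obtain ⟨K, hKc, hKs, hK⟩ := exists_isSeparable_ae_inner_eq_zero P Y hY u hu
  have : CompleteSpace K := hKc.completeSpace_coe
  have : TopologicalSpace.SeparableSpace K := hKs.separableSpace
  have : SecondCountableTopology K := UniformSpace.secondCountable_of_separable K
  set Q := K.orthogonalProjectionOnto with hQ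
  set Y₀ : Z → K := fun z => Q (Y z) with hY₀
  set Y₁ : Z → 𝓗 := fun z => Y z - Q (Y z) with hY₁
  have hperp : ∀ x : 𝓗, x - Q x ∈ Kᗮ := fun x => by
    have := K.sub_starProjection_mem_orthogonal x
    rwa [Submodule.starProjection_apply] at this
  have hpyth : ∀ x : 𝓗, ‖Q x‖ ^ 2 + ‖x - Q x‖ ^ 2 = ‖x‖ ^ 2 := fun x => by
    have h0 : ⟪(Q x : 𝓗), x - Q x⟫ = 0 := (K.mem_orthogonal _).1 (hperp x) _ (Q x).2
    have := norm_add_sq_real (Q x : 𝓗) (x - Q x)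
    rw [h0, add_sub_cancel] at this
    rw [this, Submodule.coe_norm]
    ring
  have hsplit : ∀ x y : 𝓗, ⟪x, y⟫ = ⟪Q x, Q y⟫ + ⟪x - Q x, y - Q y⟫ := fun x y => by
    have h1 : ⟪(Q x : 𝓗), y - Q y⟫ = 0 := (K.mem_orthogonal _).1 (hperp y) _ (Q x).2
    have h2 : ⟪x - Q x, (Q y : 𝓗)⟫ = 0 := (K.mem_orthogonal' _).1 (hperp x) _ (Q y).2
    conv_lhs => rw [← add_sub_cancel (Q x : 𝓗) x, ← add_sub_cancel (Q y : 𝓗) y]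
    rw [inner_add_left, inner_add_right, inner_add_right, h1, h2, Submodule.coe_inner]
    ring
  have hinner₁ : ∀ w ∈ Kᗮ, ∀ y : 𝓗, ⟪w, y - Q y⟫ = ⟪w, y⟫ := fun w hw y => by
    rw [inner_sub_right, (K.mem_orthogonal' _).1 hw _ (Q y).2, sub_zero]
  have hY₀m : Measurable Y₀ := Q.continuous.measurable.comp hY
  have hηm : Measurable fun z => ‖Y₁ z‖ :=
    (by fun_prop : Continuous fun x : 𝓗 => ‖x - Q x‖).measurable.comp hY
  choose Bad hBadm hBadP hBad using fun k => exists_measurableSet_uniform_deviation P Y₀ hY₀m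
    (fun z => ‖Y₁ z‖) hηm u (fun z => (hpyth (Y z)).le.trans (hu z)) m (B k) (hB k) (ε k) (hε k)
  set ν : Measure (Fin m → Z) := Measure.pi fun _ => P with hν
  have hrel : ∀ z, ∀ᵐ z' ∂P, ¬ ⟪Y₁ z, Y₁ z'⟫ ≠ 0 := fun z => by
    filter_upwards [hK _ (hperp (Y z))] with z' hz'
    rw [not_not, hinner₁ _ (hperp (Y z)), hz']
  have hgood : ∀ S : Fin m → Z, (∀ i j, i ≠ j → ⟪Y₁ (S i), Y₁ (S j)⟫ = 0) →
      S ∉ ⋃ k, Bad k → S ∈ A := fun S hS hSB => by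
    refine hA S fun k w hw => ?_
    obtain ⟨c, hc, hcw⟩ := exists_coefficients_of_orthogonal (fun i => Y₁ (S i)) hS (w - Q w)
    have hmain := hBad k S (fun h => hSB (Set.mem_iUnion.2 ⟨k, h⟩)) (Q w) c
      (by have := pow_le_pow_left₀ (norm_nonneg w) hw 2; linarith [hpyth w])
    have hmean : ∫ z, clippedLoss ⟪w, Y z⟫ ∂P = ∫ z, clippedLoss ⟪Q w, Y₀ z⟫ ∂P := by
      refine integral_congr_ae ?_
      filter_upwards [hK _ (hperp w)] with z hz
      rw [hsplit, hinner₁ _ (hperp w), hz, add_zero]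
    simp only [← hcw] at hmain
    exact le_of_eq_of_le (Finset.sum_congr rfl fun i _ => by rw [hmean, hsplit w (Y (S i))]) hmain
  set M := toMeasurable ν A with hM
  have hMm : MeasurableSet M := measurableSet_toMeasurable _ _
  have hnull : ν (Mᶜ \ ⋃ k, Bad k) = 0 := by
    refine measure_pi_eq_zero_of_exists_rel P (fun z z' => ⟪Y₁ z, Y₁ z'⟫ ≠ 0)
      (fun z z' h => by rwa [real_inner_comm]) hrel m _
      (hMm.compl.diff (MeasurableSet.iUnion hBadm)) fun S hS => ?_
    by_contra! hcon
    exact hS.1 (subset_toMeasurable _ _ (hgood S hcon hS.2))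
  have hcompl : ν Mᶜ ≤ ENNReal.ofReal δ :=
    calc ν Mᶜ ≤ ν ((Mᶜ \ ⋃ k, Bad k) ∪ ⋃ k, Bad k) := measure_mono fun S hS => by
          by_cases h : S ∈ ⋃ k, Bad k
          exacts [Or.inr h, Or.inl ⟨hS, h⟩]
      _ ≤ ν (Mᶜ \ ⋃ k, Bad k) + ν (⋃ k, Bad k) := measure_union_le _ _
      _ ≤ ∑' k, ν (Bad k) := by rw [hnull, zero_add]; exact measure_iUnion_le _
      _ ≤ _ := (ENNReal.tsum_le_tsum hBadP).trans hδ
  rw [← measure_toMeasurable A, ← compl_compl (toMeasurable ν A), prob_compl_eq_one_sub hMm.compl,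
    ENNReal.ofReal_sub _ hδ0, ENNReal.ofReal_one]
  exact tsub_le_tsub_left hcompl 1

/-- The confidence budget: the failure probabilities of all levels `k` add up to at most `δ`. -/
theorem tsum_ofReal_exp_le (m : ℕ) (hm : 1 ≤ m) (δ : ℝ) (hδ : δ ∈ Set.Ioo (0 : ℝ) 1) :
    ∑' k : ℕ, ENNReal.ofReal (Real.exp (-2 * m * (Real.sqrt (Real.log (k + 1 : ℕ) / m)
      + Real.sqrt (Real.log (2 / δ) / (2 * m))) ^ 2)) ≤ ENNReal.ofReal δ := by
  have hm' : (0 : ℝ) < m := by exact_mod_cast hm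
  have hlog : 0 ≤ Real.log (2 / δ) := Real.log_nonneg (by
    rw [le_div_iff₀ hδ.1]; linarith [hδ.2])
  have hterm : ∀ k : ℕ, Real.exp (-2 * m * (Real.sqrt (Real.log (k + 1 : ℕ) / m)
      + Real.sqrt (Real.log (2 / δ) / (2 * m))) ^ 2) ≤
        1 / ((k + 1 : ℕ) : ℝ) ^ 2 * (δ / 2) := fun k => by
    have hk : (0 : ℝ) < (k + 1 : ℕ) := by positivity
    have hlk : 0 ≤ Real.log (k + 1 : ℕ) := Real.log_nonneg (by exact_mod_cast Nat.succ_pos k)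
    have h1 := Real.sq_sqrt (div_nonneg hlk hm'.le)
    have h2 := Real.sq_sqrt (div_nonneg hlog (by positivity : (0 : ℝ) ≤ 2 * m))
    set a := Real.sqrt (Real.log (k + 1 : ℕ) / m)
    set b := Real.sqrt (Real.log (2 / δ) / (2 * m))
    have hab : 0 ≤ a * b := by positivity
    have h1' : m * a ^ 2 = Real.log (k + 1 : ℕ) := by rw [h1]; field_simp
    have h2' : 2 * m * b ^ 2 = Real.log (2 / δ) := by rw [h2]; field_simp
    have hexp : Real.exp (-2 * Real.log (k + 1 : ℕ) - Real.log (2 / δ))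
        = 1 / ((k + 1 : ℕ) : ℝ) ^ 2 * (δ / 2) := by
      rw [sub_eq_add_neg, Real.exp_add, Real.exp_neg, Real.exp_log (by have := hδ.1; positivity),
        inv_div]
      congr 1
      rw [show -2 * Real.log (k + 1 : ℕ) = -(Real.log (k + 1 : ℕ) + Real.log (k + 1 : ℕ)) by ring,
        Real.exp_neg, Real.exp_add, Real.exp_log hk, one_div, sq]
    rw [← hexp]
    refine Real.exp_le_exp.2 ?_
    nlinarith [mul_nonneg hm'.le hab]
  have hz := (hasSum_nat_add_iff' 1).2 hasSum_zeta_two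
  simp only [Finset.sum_range_one, Nat.cast_zero, ne_eq, OfNat.ofNat_ne_zero, not_false_eq_true,
    zero_pow, div_zero, sub_zero] at hz
  have hz2 := hz.mul_right (δ / 2)
  refine (ENNReal.tsum_le_tsum fun k => ENNReal.ofReal_le_ofReal (hterm k)).trans ?_
  rw [← ENNReal.ofReal_tsum_of_nonneg (fun k => by have := hδ.1; positivity) hz2.summable,
    hz2.tsum_eq]
  refine ENNReal.ofReal_le_ofReal ?_
  have hpi : Real.pi ^ 2 ≤ 12 := by nlinarith [Real.pi_lt_d2, Real.pi_pos]
  nlinarith [hδ.1]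

theorem gram_mulVec_apply {𝓗 X : Type*} [NormedAddCommGroup 𝓗] [InnerProductSpace ℝ 𝓗]
    (ψ : X → 𝓗) {m : ℕ} (x : Fin m → X) (α : Fin m → ℝ) (i : Fin m) :
    (gram ψ x *ᵥ α) i = ⟪∑ j, α j • ψ (x j), ψ (x i)⟫ := by
  rw [sum_inner, mulVec, dotProduct]
  refine Finset.sum_congr rfl fun j _ => ?_
  rw [real_inner_smul_left, real_inner_comm, mul_comm]
  rfl

theorem dotProduct_gram_mulVec {𝓗 X : Type*} [NormedAddCommGroup 𝓗] [InnerProductSpace ℝ 𝓗]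
    (ψ : X → 𝓗) {m : ℕ} (x : Fin m → X) (α : Fin m → ℝ) :
    α ⬝ᵥ (gram ψ x *ᵥ α) = ‖∑ j, α j • ψ (x j)‖ ^ 2 := by
  rw [← real_inner_self_eq_norm_sq, inner_sum]
  refine Finset.sum_congr rfl fun i _ => ?_
  rw [gram_mulVec_apply, real_inner_smul_right]

theorem clippedLoss_div_le_phi (ζ z : ℝ) : clippedLoss (z / ζ) ≤ phi 2 ζ z := min_le_right _ _

/-- The labelled feature map `(x, y) ↦ y ψ(x)`. -/
noncomputable def signedFeature {𝓗 X : Type*} [NormedAddCommGroup 𝓗] [InnerProductSpace ℝ 𝓗]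
    (ψ : X → 𝓗) (p : X × ({-1, 1} : Set ℝ)) : 𝓗 := (p.2 : ℝ) • ψ p.1

theorem measurable_signedFeature {𝓗 X : Type*} [NormedAddCommGroup 𝓗] [InnerProductSpace ℝ 𝓗]
    [MeasurableSpace 𝓗] [BorelSpace 𝓗] [MeasurableSpace X] {ψ : X → 𝓗} (hψ : Measurable ψ) :
    Measurable (signedFeature ψ) := by
  have h1 : Measurable fun p : X × ({-1, 1} : Set ℝ) => ψ p.1 := hψ.comp measurable_fst
  have h : signedFeature ψ = fun p => if (p.2 : ℝ) = 1 then ψ p.1 else -ψ p.1 := by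
    funext p
    rcases p.2.2 with h | h
    · simp only [signedFeature]
      rw [h]
      norm_num
    · simp only [signedFeature]
      rw [Set.mem_singleton_iff.1 h]
      norm_num
  rw [h]
  refine Measurable.ite ?_ h1 (continuous_neg.measurable.comp h1)
  exact (measurable_subtype_coe.comp measurable_snd) (measurableSet_singleton (1 : ℝ))

theorem norm_signedFeature_sq {𝓗 X : Type*} [NormedAddCommGroup 𝓗] [InnerProductSpace ℝ 𝓗]
    (ψ : X → 𝓗) (p : X × ({-1, 1} : Set ℝ)) : ‖signedFeature ψ p‖ ^ 2 = ⟪ψ p.1, ψ p.1⟫ := by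
  have h : (p.2 : ℝ) ^ 2 = 1 := by
    rcases p.2.2 with h | h
    · rw [h]; norm_num
    · rw [Set.mem_singleton_iff.1 h]; norm_num
  rw [signedFeature, norm_smul, mul_pow, Real.norm_eq_abs, sq_abs, h, one_mul,
    real_inner_self_eq_norm_sq]

theorem inner_smul_signedFeature {𝓗 X : Type*} [NormedAddCommGroup 𝓗] [InnerProductSpace ℝ 𝓗]
    (ψ : X → 𝓗) (w : 𝓗) (ζ : ℝ) (p : X × ({-1, 1} : Set ℝ)) :
    ⟪ζ⁻¹ • w, signedFeature ψ p⟫ = ((p.2 : ℝ) * ⟪w, ψ p.1⟫) / ζ := by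
  rw [signedFeature, real_inner_smul_left, real_inner_smul_right, div_eq_inv_mul]

theorem robustRisk_le_integral_clippedLoss {𝓗 X : Type*} [NormedAddCommGroup 𝓗]
    [InnerProductSpace ℝ 𝓗] [MeasurableSpace 𝓗] [BorelSpace 𝓗] [MeasurableSpace X] {ψ : X → 𝓗}
    (hψ : Measurable ψ) (P : Measure (X × ({-1, 1} : Set ℝ))) [IsProbabilityMeasure P] (w : 𝓗)
    {ζ : ℝ} (hζ : 0 < ζ) :
    (P {p | (p.2 : ℝ) * ⟪w, ψ p.1⟫ ≤ ζ}).toReal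
      ≤ ∫ p, clippedLoss ⟪ζ⁻¹ • w, signedFeature ψ p⟫ ∂P := by
  have hY := measurable_signedFeature hψ
  have hset : {p : X × ({-1, 1} : Set ℝ) | (p.2 : ℝ) * ⟪w, ψ p.1⟫ ≤ ζ}
      = {p | ⟪ζ⁻¹ • w, signedFeature ψ p⟫ ≤ 1} := by
    ext p
    simp only [Set.mem_ofPred_eq, inner_smul_signedFeature, div_le_one hζ]
  have hms : MeasurableSet {p | ⟪ζ⁻¹ • w, signedFeature ψ p⟫ ≤ 1} :=
    measurableSet_le ((continuous_const.inner continuous_id :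
      Continuous fun x => ⟪ζ⁻¹ • w, x⟫).measurable.comp hY) measurable_const
  rw [hset, ← Measure.real, ← integral_indicator_one hms]
  refine integral_mono ((integrable_const (1 : ℝ)).indicator hms)
    (integrable_clippedLoss_inner P hY _) fun p => ?_
  refine Set.indicator_apply_le' (fun hp => ?_) fun _ => clippedLoss_nonneg _
  rw [clippedLoss_eq_one hp]
  rfl

/-- Discretization of the margin: every `ζ ∈ (0, r]` lies within a factor `γ` of some `r / γᵏ⁺¹`. -/
theorem exists_pow_margin {γ r ζ : ℝ} (hγ : 1 < γ) (hr : 0 < r) (hζ : ζ ∈ Set.Ioc (0 : ℝ) r) :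
    ∃ k : ℕ, ζ⁻¹ ≤ γ ^ (k + 1) / r ∧ γ ^ (k + 1) / r ≤ γ / ζ ∧
      ((k + 1 : ℕ) : ℝ) ≤ Real.log (γ * r / ζ) / Real.log γ := by
  have hγ0 : 0 < γ := by linarith
  obtain ⟨hζ0, hζr⟩ := hζ
  obtain ⟨k, hk, hk'⟩ := exists_nat_pow_near ((one_le_div hζ0).2 hζr) hγ
  have hk2 : γ ^ (k + 1) ≤ γ * r / ζ := by
    rw [pow_succ', mul_div_assoc]
    exact mul_le_mul_of_nonneg_left hk hγ0.le
  refine ⟨k, ?_, ?_, ?_⟩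
  · rw [le_div_iff₀ hr, inv_mul_eq_div]
    exact hk'.le
  · rw [div_le_iff₀ hr, div_mul_eq_mul_div]
    exact hk2
  · rw [le_div_iff₀ (Real.log_pos hγ), ← Real.log_pow]
    exact Real.log_le_log (by positivity) hk2

theorem statement6 {𝓗 X : Type*} [NormedAddCommGroup 𝓗] [InnerProductSpace ℝ 𝓗]
    [CompleteSpace 𝓗] [MeasurableSpace 𝓗] [BorelSpace 𝓗] [MeasurableSpace X]
    (ψ : X → 𝓗) (hψ : Measurable ψ)
    (u : ℝ) (hu : ∀ x : X, ⟪ψ x, ψ x⟫ ≤ u ^ 2)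
    (P : Measure (X × ({-1, 1} : Set ℝ))) [IsProbabilityMeasure P]
    (v : ℝ) (hv : 0 < v) (γ : ℝ) (hγ : 1 < γ) (r : ℝ) (hr : 0 < r)
    (δ : ℝ) (hδ : δ ∈ Set.Ioo (0 : ℝ) 1) (m : ℕ) (hm : 1 ≤ m) :
    ENNReal.ofReal (1 - δ) ≤
      (Measure.pi fun _ : Fin m => P)
        {S : Fin m → X × ({-1, 1} : Set ℝ) |
          ∀ ζ ∈ Set.Ioc (0 : ℝ) r,
            (⨅ w : {w : 𝓗 // ‖w‖ ≤ v},
                (P {p : X × ({-1, 1} : Set ℝ) | (p.2 : ℝ) * ⟪w.1, ψ p.1⟫ ≤ ζ}).toReal)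
              - (⨅ α : {α : Fin m → ℝ //
                    α ⬝ᵥ (gram ψ (fun i => (S i).1) *ᵥ α) ≤ v ^ 2},
                  ((m : ℝ))⁻¹ *
                    ∑ i, phi 2 ζ (((S i).2 : ℝ) * (gram ψ (fun i => (S i).1) *ᵥ α.1) i)) ≤
              (2 * γ / ζ) * Real.sqrt (u ^ 2 * v ^ 2 / m)
                + Real.sqrt (Real.log (Real.log (γ * r / ζ) / Real.log γ) / m)
                + Real.sqrt (Real.log (2 / δ) / (2 * m))} := by
  have hm' : (0 : ℝ) < m := by exact_mod_cast hm
  have hγ0 : 0 < γ := by linarith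
  refine ofReal_le_measure_of_uniform_deviation P (signedFeature ψ) (measurable_signedFeature hψ) u
    (fun p => (norm_signedFeature_sq ψ p).le.trans (hu p.1)) m (fun k => v * (γ ^ (k + 1) / r))
    (fun k => Real.sqrt (Real.log (k + 1 : ℕ) / m) + Real.sqrt (Real.log (2 / δ) / (2 * m)))
    (fun k => by positivity) (fun k => by positivity) δ hδ.1.le (tsum_ofReal_exp_le m hm δ hδ) _
    fun S hS ζ hζ => ?_
  obtain ⟨k, hk, hk', hklog⟩ := exists_pow_margin hγ hr hζ
  have hζ0 : 0 < ζ := hζ.1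
  have : Nonempty {α : Fin m → ℝ // α ⬝ᵥ (gram ψ (fun i => (S i).1) *ᵥ α) ≤ v ^ 2} :=
    ⟨⟨0, by simpa using sq_nonneg v⟩⟩
  rw [sub_le_comm]
  refine le_ciInf fun α => ?_
  rw [sub_le_comm]
  set w : 𝓗 := ∑ j, α.1 j • ψ (S j).1 with hw
  have hwv : ‖w‖ ≤ v := by
    refine abs_le_of_sq_le_sq' ?_ hv.le |>.2
    rw [hw, ← dotProduct_gram_mulVec ψ (fun i => (S i).1)]
    exact α.2
  have hinf : (⨅ w : {w : 𝓗 // ‖w‖ ≤ v},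
      (P {p : X × ({-1, 1} : Set ℝ) | (p.2 : ℝ) * ⟪w.1, ψ p.1⟫ ≤ ζ}).toReal)
      ≤ ∫ p, clippedLoss ⟪ζ⁻¹ • w, signedFeature ψ p⟫ ∂P :=
    (ciInf_le ⟨0, by rintro _ ⟨w, rfl⟩; exact ENNReal.toReal_nonneg⟩
      (⟨w, hwv⟩ : {w : 𝓗 // ‖w‖ ≤ v})).trans
      (robustRisk_le_integral_clippedLoss hψ P w hζ0)
  have hdev := hS k (ζ⁻¹ • w) (by
    rw [norm_smul, norm_inv, Real.norm_of_nonneg hζ0.le, mul_comm v]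
    exact mul_le_mul hk hwv (norm_nonneg _) (by positivity))
  have hloss : ∑ i, clippedLoss ⟪ζ⁻¹ • w, signedFeature ψ (S i)⟫
      ≤ ∑ i, phi 2 ζ (((S i).2 : ℝ) * (gram ψ (fun i => (S i).1) *ᵥ α.1) i) :=
    Finset.sum_le_sum fun i _ => by
      rw [inner_smul_signedFeature, gram_mulVec_apply]
      exact clippedLoss_div_le_phi _ _
  rw [Finset.sum_sub_distrib, Finset.sum_const, Finset.card_univ, Fintype.card_fin,
    nsmul_eq_mul] at hdev
  have hlog : Real.sqrt (Real.log (k + 1 : ℕ) / m)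
      ≤ Real.sqrt (Real.log (Real.log (γ * r / ζ) / Real.log γ) / m) :=
    Real.sqrt_le_sqrt (div_le_div_of_nonneg_right
      (Real.log_le_log (by positivity) hklog) hm'.le)
  have hcomplexity : (m : ℝ)⁻¹ * (2 * (v * (γ ^ (k + 1) / r)) * Real.sqrt (m * u ^ 2))
      ≤ (2 * γ / ζ) * Real.sqrt (u ^ 2 * v ^ 2 / m) := by
    have h1 : (m : ℝ)⁻¹ * Real.sqrt (m * u ^ 2) = Real.sqrt (u ^ 2 / m) := by
      rw [show u ^ 2 / m = (m * u ^ 2) / (m : ℝ) ^ 2 by field_simp, Real.sqrt_div (by positivity),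
        Real.sqrt_sq hm'.le, div_eq_inv_mul]
    have h2 : Real.sqrt (u ^ 2 * v ^ 2 / m) = v * Real.sqrt (u ^ 2 / m) := by
      rw [show u ^ 2 * v ^ 2 / m = v ^ 2 * (u ^ 2 / m) by ring, Real.sqrt_mul (sq_nonneg v),
        Real.sqrt_sq hv.le]
    calc _ = 2 * v * Real.sqrt (u ^ 2 / m) * (γ ^ (k + 1) / r) := by rw [← h1]; ring
      _ ≤ 2 * v * Real.sqrt (u ^ 2 / m) * (γ / ζ) :=
          mul_le_mul_of_nonneg_left hk' (by positivity)
      _ = _ := by rw [h2]; ring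
  have hscaled := mul_le_mul_of_nonneg_left hdev (inv_nonneg.2 hm'.le)
  have hlossm := mul_le_mul_of_nonneg_left hloss (inv_nonneg.2 hm'.le)
  rw [mul_sub, mul_add, inv_mul_cancel_left₀ hm'.ne', inv_mul_cancel_left₀ hm'.ne'] at hscaled
  linarith
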